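/- Let 𝒳, 𝒴, 𝓑 be finite sets with |𝓑| ≥ 2, and π_{XY} a distribution on 𝒳×𝒴 such that there exists y ∈ 𝒴 with π_{Y|X}(y|x) > 0 for every x with π_X(x) > 0. Let Ψ : ℝ → [0,+∞] be defined as the minimum, over finite auxiliary alphabets 𝒰, 𝒱 and distributions P_{UV}, P_{B|XUV}, P_{Y|BUV} satisfying H(U|V) ≤ H(BU|XYV) + t, of D(P_{Y|XV} ‖ π_{Y|X} | π_X P_V), with entropies evaluated under π_X P_{UV} P_{B|XUV} P_{Y|BUV}, and let t_min = inf{t : Ψ(t) < +∞}. Then Ψ(t) < +∞ for every t > −log|𝓑|; in particular t_min ≤ −log|𝓑| < 0. -/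

import Mathlib

open scoped BigOperators ENNReal
open Classical

noncomputable section

/-- `p` is a probability mass function on the finite type `α`. -/
def IsDist {α : Type} [Fintype α] (p : α → ℝ) : Prop :=
  (∀ a, 0 ≤ p a) ∧ (∑ a, p a) = 1

/-- `k` is a conditional probability kernel. -/
def IsKernel {α β : Type} [Fintype β] (k : α → β → ℝ) : Prop :=
  ∀ a, (∀ b, 0 ≤ k a b) ∧ (∑ b, k a b) = 1

/-- Marginal (pushforward) of `p` along the map `f`. -/
def marg {α β : Type} [Fintype α] (f : α → β) (p : α → ℝ) : β → ℝ :=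
  fun b => ∑ a, if f a = b then p a else 0

/-- Shannon entropy (natural log). -/
def ent {α : Type} [Fintype α] (p : α → ℝ) : ℝ :=
  ∑ a, Real.negMulLog (p a)

/-- Conditional entropy `H(f(A) | g(A))` for `A ∼ p`. -/
def condEnt {α β γ : Type} [Fintype α] [Fintype β] [Fintype γ]
    (f : α → β) (g : α → γ) (p : α → ℝ) : ℝ :=
  ent (marg (fun a => (f a, g a)) p) - ent (marg g p)

/-- Kullback–Leibler divergence `D(p‖q)` with value `⊤` if `p` is not absolutely
continuous with respect to `q`. -/
def KL {α : Type} [Fintype α] (p q : α → ℝ) : ℝ≥0∞ :=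
  if ∀ a, q a = 0 → p a = 0 then ENNReal.ofReal (∑ a, p a * Real.log (p a / q a)) else ⊤

/-- The joint distribution `π_X P_{UV} P_{B|XUV} P_{Y|BUV}` on `X × U × V × B × Y`. -/
def seqJoint {X Y B U V : Type} (πX : X → ℝ) (PUV : U × V → ℝ)
    (PB : X × U × V → B → ℝ) (PY : B × U × V → Y → ℝ) : X × U × V × B × Y → ℝ :=
  fun q => πX q.1 * PUV (q.2.1, q.2.2.1) * PB (q.1, q.2.1, q.2.2.1) q.2.2.2.1 *
    PY (q.2.2.2.1, q.2.1, q.2.2.1) q.2.2.2.2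

/-- The set of values `D(P_{Y|XV} ‖ π_{Y|X} | π_X P_V)` over all feasible tuples
`(𝒰, 𝒱, P_{UV}, P_{B|XUV}, P_{Y|BUV})` with `H(U|V) ≤ H(BU|XYV) + t`. -/
def psiSet (X Y B : Type) [Fintype X] [Fintype Y] [Fintype B] (π : X × Y → ℝ) (t : ℝ) :
    Set ℝ≥0∞ :=
  { d | ∃ (m l : ℕ) (PUV : Fin m × Fin l → ℝ)
      (PB : X × Fin m × Fin l → B → ℝ) (PY : B × Fin m × Fin l → Y → ℝ),
      IsDist PUV ∧ IsKernel PB ∧ IsKernel PY ∧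
      condEnt (fun q : X × Fin m × Fin l × B × Y => q.2.1)
          (fun q => q.2.2.1) (seqJoint (marg Prod.fst π) PUV PB PY) ≤
        condEnt (fun q : X × Fin m × Fin l × B × Y => (q.2.2.2.1, q.2.1))
          (fun q => (q.1, q.2.2.2.2, q.2.2.1)) (seqJoint (marg Prod.fst π) PUV PB PY) + t ∧
      d = KL (marg (fun q : X × Fin m × Fin l × B × Y => (q.1, q.2.2.1, q.2.2.2.2))
              (seqJoint (marg Prod.fst π) PUV PB PY))
            (fun r : X × Fin l × Y => marg Prod.snd PUV r.2.1 * π (r.1, r.2.2)) }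

/-- `Ψ(t)`, with the convention `Ψ(t) = ⊤` when there is no feasible tuple. -/
def Psi (X Y B : Type) [Fintype X] [Fintype Y] [Fintype B] (π : X × Y → ℝ) (t : ℝ) : ℝ≥0∞ :=
  sInf (psiSet X Y B π t)

theorem marg_apply_of_injective {α β : Type} [Fintype α] {f : α → β}
    (hf : Function.Injective f) (p : α → ℝ) (a : α) : marg f p (f a) = p a := by
  simp [marg, hf.eq_iff]

theorem sum_marg {α β : Type} [Fintype α] [Fintype β] (f : α → β) (p : α → ℝ) :
    ∑ b, marg f p b = ∑ a, p a := by
  simp only [marg]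
  rw [Finset.sum_comm]
  simp

theorem ent_eq_zero_of_subsingleton {α : Type} [Fintype α] [Subsingleton α] {p : α → ℝ}
    (hp : ∑ a, p a = 1) : ent p = 0 := by
  refine Finset.sum_eq_zero fun a _ => ?_
  rw [Fintype.sum_subsingleton p a] at hp
  rw [hp, Real.negMulLog_one]

section UniformRelay

variable {X Y B : Type} [Fintype B]

/-- The joint distribution in which `U` and `V` are trivial, `B` is uniform and independent of
`X`, and `Y = y₀`. -/
def uniformRelay (B : Type) [Fintype B] (πX : X → ℝ) (y₀ : Y) :
    X × Fin 1 × Fin 1 × B × Y → ℝ :=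
  seqJoint πX (fun _ => 1) (fun _ _ => (Fintype.card B : ℝ)⁻¹)
    (fun _ y => if y = y₀ then 1 else 0)

theorem uniformRelay_apply (πX : X → ℝ) (y₀ : Y) (q : X × Fin 1 × Fin 1 × B × Y) :
    uniformRelay B πX y₀ q =
      if q.2.2.2.2 = y₀ then πX q.1 * (Fintype.card B : ℝ)⁻¹ else 0 := by
  simp [uniformRelay, seqJoint]

variable [Fintype X] [Fintype Y]

theorem sum_uniformRelay [Nonempty B] {πX : X → ℝ} (hX : ∑ x, πX x = 1) (y₀ : Y) :
    ∑ q, uniformRelay B πX y₀ q = 1 := by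
  simp [uniformRelay_apply, Fintype.sum_prod_type, mul_left_comm, hX]

theorem marg_uniformRelay [Nonempty B] (πX : X → ℝ) (y₀ : Y) (x : X) (v : Fin 1) (y : Y) :
    marg (fun q : X × Fin 1 × Fin 1 × B × Y => (q.1, q.2.2.1, q.2.2.2.2))
      (uniformRelay B πX y₀) (x, v, y) = if y = y₀ then πX x else 0 := by
  have hB : (Fintype.card B : ℝ) ≠ 0 := by simp
  simp only [marg, uniformRelay_apply, Fintype.sum_prod_type, Prod.mk.injEq, ite_and,
    Subsingleton.elim _ v]
  simp only [Finset.sum_ite_eq', Finset.sum_const, Finset.sum_ite_irrel, Finset.mem_univ,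
    if_true, Finset.card_univ]
  split_ifs <;> simp [mul_left_comm, hB]

theorem marg_uniformRelay_output [Nonempty B] (πX : X → ℝ) (y₀ : Y) (x : X) (y : Y)
    (v : Fin 1) :
    marg (fun q : X × Fin 1 × Fin 1 × B × Y => (q.1, q.2.2.2.2, q.2.2.1))
      (uniformRelay B πX y₀) (x, y, v) = if y = y₀ then πX x else 0 := by
  rw [← marg_uniformRelay (B := B) πX y₀ x v y]
  simp only [marg, Prod.mk.injEq, and_comm]

theorem condEnt_uniformRelay_aux [Nonempty B] {πX : X → ℝ} (hX : ∑ x, πX x = 1) (y₀ : Y) :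
    condEnt (fun q : X × Fin 1 × Fin 1 × B × Y => q.2.1) (fun q => q.2.2.1)
      (uniformRelay B πX y₀) = 0 := by
  rw [condEnt, ent_eq_zero_of_subsingleton ((sum_marg _ _).trans (sum_uniformRelay hX y₀)),
    ent_eq_zero_of_subsingleton ((sum_marg _ _).trans (sum_uniformRelay hX y₀)), sub_zero]

theorem condEnt_uniformRelay_relay [Nonempty B] {πX : X → ℝ} (hX : ∑ x, πX x = 1) (y₀ : Y) :
    condEnt (fun q : X × Fin 1 × Fin 1 × B × Y => (q.2.2.2.1, q.2.1))
      (fun q => (q.1, q.2.2.2.2, q.2.2.1)) (uniformRelay B πX y₀) =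
      Real.log (Fintype.card B) := by
  have hB : (Fintype.card B : ℝ) ≠ 0 := by simp
  have hjoint (b : B) (u v : Fin 1) (x : X) (y : Y) :
      marg (fun q : X × Fin 1 × Fin 1 × B × Y =>
          ((q.2.2.2.1, q.2.1), (q.1, q.2.2.2.2, q.2.2.1))) (uniformRelay B πX y₀)
        ((b, u), (x, y, v)) = if y = y₀ then πX x * (Fintype.card B : ℝ)⁻¹ else 0 := by
    rw [← uniformRelay_apply πX y₀ (x, u, v, b, y)]
    refine marg_apply_of_injective (f := fun q : X × Fin 1 × Fin 1 × B × Y =>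
      ((q.2.2.2.1, q.2.1), (q.1, q.2.2.2.2, q.2.2.1))) ?_ _ (x, u, v, b, y)
    rintro ⟨x, u, v, b, y⟩ ⟨x', u', v', b', y'⟩ h
    simp_all
  simp only [condEnt, ent, Fintype.sum_prod_type, hjoint, marg_uniformRelay_output]
  simp [apply_ite Real.negMulLog, Real.negMulLog_mul, Finset.sum_add_distrib,
    ← Finset.mul_sum, ← Finset.sum_mul, hX]
  simp [Real.negMulLog, hB]

end UniformRelay

theorem Psi_lt_top_of_neg_log_card_le
    {X Y B : Type} [Fintype X] [Fintype Y] [Fintype B] [Nonempty B]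
    {π : X × Y → ℝ} (hπ : IsDist π)
    (hy : ∃ y : Y, ∀ x : X, 0 < marg Prod.fst π x → 0 < π (x, y))
    {t : ℝ} (ht : -Real.log (Fintype.card B) ≤ t) : Psi X Y B π t < ⊤ := by
  obtain ⟨y₀, hy₀⟩ := hy
  have hX : ∑ x, marg Prod.fst π x = 1 := (sum_marg _ _).trans hπ.2
  have hX0 (x : X) : 0 ≤ marg Prod.fst π x :=
    Finset.sum_nonneg fun a _ => by split_ifs <;> simp [hπ.1 a]
  refine lt_of_le_of_lt (sInf_le ⟨1, 1, fun _ => 1, fun _ _ => (Fintype.card B : ℝ)⁻¹,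
    fun _ y => if y = y₀ then 1 else 0, ⟨fun _ => zero_le_one, by simp⟩,
    fun _ => ⟨fun _ => by positivity, by simp⟩,
    fun _ => ⟨fun y => by dsimp only; split_ifs <;> norm_num, by simp⟩, ?_, rfl⟩) ?_
  · have h₁ := condEnt_uniformRelay_aux (B := B) hX y₀
    have h₂ := condEnt_uniformRelay_relay (B := B) hX y₀
    rw [uniformRelay] at h₁ h₂
    rw [h₁, h₂]
    linarith
  · rw [KL, if_pos]
    · exact ENNReal.ofReal_lt_top
    rintro ⟨x, v, y⟩ h
    refine (marg_uniformRelay (B := B) _ y₀ x v y).trans (ite_eq_right_iff.2 ?_)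
    rintro rfl
    have hv : marg Prod.snd (fun _ : Fin 1 × Fin 1 => (1 : ℝ)) v = 1 := by
      simp [marg, Subsingleton.elim _ v]
    simp only [hv, one_mul] at h
    by_contra hne
    exact (hy₀ x (lt_of_le_of_ne (hX0 x) (Ne.symm hne))).ne' h

/-- if `|𝓑| ≥ 2` and some `y` satisfies `π_{Y|X}(y|x) > 0` for every `x`
with `π_X(x) > 0`, then `Ψ(t) < +∞` for every `t > -log|𝓑|`; in particular
`t_min ≤ -log|𝓑| < 0`. -/
theorem Psi_finite_above_neg_log_card
    (X Y B : Type) [Fintype X] [Fintype Y] [Fintype B]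
    (π : X × Y → ℝ) (hπ : IsDist π)
    (hB : 2 ≤ Fintype.card B)
    (hy : ∃ y : Y, ∀ x : X, 0 < marg Prod.fst π x → 0 < π (x, y)) :
    (∀ t : ℝ, -Real.log (Fintype.card B) < t → Psi X Y B π t < ⊤) ∧
    (∀ tmin : ℝ, IsGLB {t : ℝ | Psi X Y B π t < ⊤} tmin →
      tmin ≤ -Real.log (Fintype.card B)) ∧
    -Real.log (Fintype.card B) < 0 := by
  have : Nonempty B := Fintype.card_pos_iff.1 (by omega)
  refine ⟨fun t ht => Psi_lt_top_of_neg_log_card_le hπ hy ht.le,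
    fun tmin h => h.1 (Psi_lt_top_of_neg_log_card_le hπ hy le_rfl), ?_⟩
  exact neg_neg_of_pos (Real.log_pos (by exact_mod_cast hB))

end
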